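/- arXiv:2408.02550 — 4 statements merged into one kernel-verified Lean document; each statement's English description precedes it below -/
import Mathlib

section
/- Let X, Y, Z be finite-valued random variables on a probability space satisfying TRIPLE(X,Y,Z). Then X, Y and Z are each uniformly distributed over their supports, their supports all have the same cardinality, and in fact P(X=x) = P(Y=y) = P(Z=z) for all x, y, z in the supports of X, Y, Z respectively. -/
namespace CIPaper

/-- A bundled probability space. -/
structure ProbSpace where
  carrier : Type
  [inst : MeasurableSpace carrier]
  μ : MeasureTheory.Measure carrier
  [isProb : MeasureTheory.IsProbabilityMeasure μ]

attribute [instance] ProbSpace.inst ProbSpace.isProb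

/-- A bundled finite measurable alphabet, used as value space of auxiliary random variables. -/
structure FinAlphabet where
  carrier : Type
  [fin : Fintype carrier]
  [ms : MeasurableSpace carrier]
  [msc : MeasurableSingletonClass carrier]

attribute [instance] FinAlphabet.fin FinAlphabet.ms FinAlphabet.msc

open MeasureTheory ProbabilityTheory Real

variable {Ω : Type*} [MeasurableSpace Ω] {S T U : Type*}

/-- P(X = x). -/
noncomputable def pr (μ : Measure Ω) (X : Ω → S) (x : S) : ℝ :=
  (μ (X ⁻¹' {x})).toReal

/-- Shannon entropy (base 2) of a finite-valued random variable. -/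
noncomputable def ent (μ : Measure Ω) [Fintype S] (X : Ω → S) : ℝ :=
  (∑ x, Real.negMulLog (pr μ X x)) / Real.log 2

/-- Conditional entropy H(X|Y). -/
noncomputable def condEnt (μ : Measure Ω) [Fintype S] [Fintype T]
    (X : Ω → S) (Y : Ω → T) : ℝ :=
  ent μ (fun ω => (X ω, Y ω)) - ent μ Y

/-- Mutual information I(X;Y). -/
noncomputable def mi (μ : Measure Ω) [Fintype S] [Fintype T]
    (X : Ω → S) (Y : Ω → T) : ℝ :=
  ent μ X + ent μ Y - ent μ (fun ω => (X ω, Y ω))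

/-- Conditional mutual information I(X;Y|Z). -/
noncomputable def cmi (μ : Measure Ω) [Fintype S] [Fintype T] [Fintype U]
    (X : Ω → S) (Y : Ω → T) (Z : Ω → U) : ℝ :=
  ent μ (fun ω => (X ω, Z ω)) + ent μ (fun ω => (Y ω, Z ω))
    - ent μ (fun ω => (X ω, (Y ω, Z ω))) - ent μ Z

/-- The support of a random variable: values of positive probability. -/
def support (μ : Measure Ω) (X : Ω → S) : Set S := {x | 0 < pr μ X x}

/-- X is uniformly distributed over its support. -/
def IsUniform (μ : Measure Ω) (X : Ω → S) : Prop :=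
  ∀ x ∈ support μ X, ∀ y ∈ support μ X, pr μ X x = pr μ X y

/-- X is uniformly distributed over a support of size n. -/
def UniformOn (μ : Measure Ω) (X : Ω → S) (n : ℕ) : Prop :=
  IsUniform μ X ∧ (support μ X).ncard = n

/-- The TRIPLE predicate: pairwise independence plus each variable a function of the
other two. -/
def TRIPLE (μ : Measure Ω) [Fintype S] [Fintype T] [Fintype U]
    (X : Ω → S) (Y : Ω → T) (Z : Ω → U) : Prop :=
  condEnt μ X (fun ω => (Y ω, Z ω)) = 0 ∧ condEnt μ Y (fun ω => (X ω, Z ω)) = 0 ∧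
    condEnt μ Z (fun ω => (X ω, Y ω)) = 0 ∧
    mi μ X Y = 0 ∧ mi μ X Z = 0 ∧ mi μ Y Z = 0

end CIPaper

namespace CIPaper

open MeasureTheory ProbabilityTheory Real

section Entropy

variable {Ω S T : Type*} [MeasurableSpace Ω]

lemma pr_nonneg (μ : Measure Ω) (X : Ω → S) (x : S) : 0 ≤ pr μ X x := ENNReal.toReal_nonneg

lemma pr_prodMk_swap (μ : Measure Ω) (X : Ω → S) (Y : Ω → T) (x : S) (y : T) :
    pr μ (fun ω => (X ω, Y ω)) (x, y) = pr μ (fun ω => (Y ω, X ω)) (y, x) := by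
  unfold pr
  congr 2
  ext ω
  simp [and_comm]

lemma sum_pr_eq_one (μ : Measure Ω) [IsProbabilityMeasure μ] [Fintype S] [MeasurableSpace S]
    [MeasurableSingletonClass S] {X : Ω → S} (hX : Measurable X) : ∑ x, pr μ X x = 1 := by
  have h := sum_measureReal_preimage_singleton (μ := μ) (f := X) Finset.univ
    (fun y _ => hX (measurableSet_singleton y))
  simpa [pr, Measure.real] using h

lemma sum_pr_prodMk_left (μ : Measure Ω) [IsProbabilityMeasure μ] [Fintype S] [MeasurableSpace S]
    [MeasurableSingletonClass S] {X : Ω → S} (hX : Measurable X) (Y : Ω → T) (y : T) :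
    ∑ x, pr μ (fun ω => (X ω, Y ω)) (x, y) = pr μ Y y := by
  have h := sum_measureReal_preimage_singleton (μ := μ.restrict (Y ⁻¹' {y})) (f := X) Finset.univ
    (fun x _ => hX (measurableSet_singleton x))
  simp only [Finset.coe_univ, Set.preimage_univ, measureReal_restrict_apply_univ] at h
  rw [show pr μ Y y = μ.real (Y ⁻¹' {y}) from rfl, ← h]
  refine Finset.sum_congr rfl fun x _ => ?_
  rw [measureReal_restrict_apply (hX (measurableSet_singleton x))]
  unfold pr Measure.real
  congr 2
  ext ω
  simp

lemma sum_pr_prodMk_right (μ : Measure Ω) [IsProbabilityMeasure μ] [Fintype T] [MeasurableSpace T]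
    [MeasurableSingletonClass T] (X : Ω → S) {Y : Ω → T} (hY : Measurable Y) (x : S) :
    ∑ y, pr μ (fun ω => (X ω, Y ω)) (x, y) = pr μ X x := by
  simp_rw [pr_prodMk_swap μ X Y]
  exact sum_pr_prodMk_left μ hY X x

lemma exists_pr_prodMk_pos (μ : Measure Ω) [IsProbabilityMeasure μ] [Fintype S]
    [MeasurableSpace S] [MeasurableSingletonClass S] {X : Ω → S} (hX : Measurable X) {Y : Ω → T}
    {y : T} (hy : 0 < pr μ Y y) : ∃ x, 0 < pr μ (fun ω => (X ω, Y ω)) (x, y) := by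
  by_contra! hneg
  rw [← sum_pr_prodMk_left μ hX Y y] at hy
  exact hy.not_ge (Finset.sum_nonpos fun x _ => hneg x)

lemma pr_prodMk_le_right (μ : Measure Ω) [IsProbabilityMeasure μ] (X : Ω → S) (Y : Ω → T)
    (x : S) (y : T) : pr μ (fun ω => (X ω, Y ω)) (x, y) ≤ pr μ Y y :=
  measureReal_mono fun _ hω => congrArg Prod.snd hω

lemma pr_prodMk_le_left (μ : Measure Ω) [IsProbabilityMeasure μ] (X : Ω → S) (Y : Ω → T)
    (x : S) (y : T) : pr μ (fun ω => (X ω, Y ω)) (x, y) ≤ pr μ X x :=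
  measureReal_mono fun _ hω => congrArg Prod.fst hω

lemma sum_negMulLog_pr_right (μ : Measure Ω) [IsProbabilityMeasure μ] [Fintype S] [Fintype T]
    [MeasurableSpace S] [MeasurableSingletonClass S] {X : Ω → S} (hX : Measurable X) (Y : Ω → T) :
    ∑ y, negMulLog (pr μ Y y)
      = ∑ q : S × T, -(pr μ (fun ω => (X ω, Y ω)) q * Real.log (pr μ Y q.2)) := by
  rw [Fintype.sum_prod_type_right]
  refine Finset.sum_congr rfl fun y _ => ?_
  dsimp only
  rw [Finset.sum_neg_distrib, ← Finset.sum_mul, sum_pr_prodMk_left μ hX Y y, negMulLog, neg_mul]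

lemma sum_negMulLog_pr_left (μ : Measure Ω) [IsProbabilityMeasure μ] [Fintype S] [Fintype T]
    [MeasurableSpace T] [MeasurableSingletonClass T] (X : Ω → S) {Y : Ω → T} (hY : Measurable Y) :
    ∑ x, negMulLog (pr μ X x)
      = ∑ q : S × T, -(pr μ (fun ω => (X ω, Y ω)) q * Real.log (pr μ X q.1)) := by
  rw [Fintype.sum_prod_type]
  refine Finset.sum_congr rfl fun x _ => ?_
  dsimp only
  rw [Finset.sum_neg_distrib, ← Finset.sum_mul, sum_pr_prodMk_right μ X hY x, negMulLog, neg_mul]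

/-- If `H(X|Y) = 0`, then `X` is almost surely determined by `Y`. -/
lemma pr_prodMk_eq_of_condEnt_eq_zero (μ : Measure Ω) [IsProbabilityMeasure μ]
    [Fintype S] [Fintype T] [MeasurableSpace S] [MeasurableSingletonClass S]
    {X : Ω → S} (hX : Measurable X) {Y : Ω → T}
    (h : condEnt μ X Y = 0) {x : S} {y : T} (hxy : 0 < pr μ (fun ω => (X ω, Y ω)) (x, y)) :
    pr μ (fun ω => (X ω, Y ω)) (x, y) = pr μ Y y := by
  set p := pr μ (fun ω => (X ω, Y ω)) with hp
  have hlog : Real.log 2 ≠ 0 := (Real.log_pos one_lt_two).ne'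
  have hY' := sum_negMulLog_pr_right μ hX Y
  have hsum : ∑ q : S × T, p q * (Real.log (pr μ Y q.2) - Real.log (p q)) = 0 := by
    unfold condEnt ent at h
    rw [← sub_div, div_eq_zero_iff, or_iff_left hlog, hY', ← Finset.sum_sub_distrib] at h
    rw [← h]
    refine Finset.sum_congr rfl fun q _ => ?_
    rw [← hp, negMulLog]
    ring
  have hnn : ∀ q ∈ Finset.univ, 0 ≤ p q * (Real.log (pr μ Y q.2) - Real.log (p q)) := by
    rintro ⟨a, b⟩ -
    rcases (pr_nonneg μ (fun ω => (X ω, Y ω)) (a, b)).eq_or_lt with h0 | h0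
    · simp [hp, ← h0]
    · exact mul_nonneg h0.le
        (sub_nonneg.2 (Real.log_le_log h0 (pr_prodMk_le_right μ X Y a b)))
  have hz := (Finset.sum_eq_zero_iff_of_nonneg hnn).1 hsum (x, y) (Finset.mem_univ _)
  have hl := (mul_eq_zero.1 hz).resolve_left hxy.ne'
  exact (Real.log_injOn_pos (Set.mem_Ioi.2 (hxy.trans_le (pr_prodMk_le_right μ X Y x y)))
    (Set.mem_Ioi.2 hxy) (sub_eq_zero.1 hl)).symm

/-- If `I(X;Y) = 0`, then the joint distribution is the product of the marginals. -/
lemma pr_prodMk_eq_mul_of_mi_eq_zero (μ : Measure Ω) [IsProbabilityMeasure μ]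
    [Fintype S] [Fintype T] [MeasurableSpace S] [MeasurableSingletonClass S]
    [MeasurableSpace T] [MeasurableSingletonClass T]
    {X : Ω → S} {Y : Ω → T} (hX : Measurable X) (hY : Measurable Y)
    (h : mi μ X Y = 0) (x : S) (y : T) :
    pr μ (fun ω => (X ω, Y ω)) (x, y) = pr μ X x * pr μ Y y := by
  set p := pr μ (fun ω => (X ω, Y ω)) with hp
  have hlog : Real.log 2 ≠ 0 := (Real.log_pos one_lt_two).ne'
  have hX' := sum_negMulLog_pr_left μ X hY
  have hY' := sum_negMulLog_pr_right μ hX Y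
  have hp1 : ∑ q, p q = 1 := sum_pr_eq_one μ (hX.prodMk hY)
  have hq1 : ∑ q : S × T, pr μ X q.1 * pr μ Y q.2 = 1 := by
    rw [Fintype.sum_prod_type, ← Fintype.sum_mul_sum, sum_pr_eq_one μ hX, sum_pr_eq_one μ hY,
      one_mul]
  let f : S × T → ℝ := fun q =>
    p q * (Real.log (p q) - Real.log (pr μ X q.1) - Real.log (pr μ Y q.2))
      - (p q - pr μ X q.1 * pr μ Y q.2)
  have hsum : ∑ q, f q = 0 := by
    unfold mi ent at h
    rw [← add_div, ← sub_div, div_eq_zero_iff, or_iff_left hlog, hX', hY',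
      ← Finset.sum_add_distrib, ← Finset.sum_sub_distrib] at h
    simp only [f]
    rw [Finset.sum_sub_distrib, Finset.sum_sub_distrib, hp1, hq1, sub_self, sub_zero, ← h]
    refine Finset.sum_congr rfl fun q _ => ?_
    rw [← hp, negMulLog]
    ring
  have hpos : ∀ q, p q ≠ pr μ X q.1 * pr μ Y q.2 → 0 < f q := by
    rintro ⟨a, b⟩ hne
    simp only [f]
    rcases (pr_nonneg μ (fun ω => (X ω, Y ω)) (a, b)).eq_or_lt with h0 | h0
    · have h0' : p (a, b) = 0 := h0.symm
      rw [h0'] at hne ⊢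
      have := (mul_nonneg (pr_nonneg μ X a) (pr_nonneg μ Y b)).lt_of_ne hne
      linarith
    · rw [← hp] at h0
      have ha : 0 < pr μ X a := h0.trans_le (pr_prodMk_le_left μ X Y a b)
      have hb : 0 < pr μ Y b := h0.trans_le (pr_prodMk_le_right μ X Y a b)
      have hlt := Real.log_lt_sub_one_of_pos (div_pos (mul_pos ha hb) h0)
        fun he => hne ((div_eq_one_iff_eq h0.ne').1 he).symm
      rw [Real.log_div (mul_pos ha hb).ne' h0.ne', Real.log_mul ha.ne' hb.ne'] at hlt
      have hm := mul_lt_mul_of_pos_left hlt h0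
      rw [mul_sub, mul_sub, mul_div_cancel₀ _ h0.ne'] at hm
      linarith
  have hnn : ∀ q ∈ Finset.univ, 0 ≤ f q := fun q _ => by
    by_cases hq : p q = pr μ X q.1 * pr μ Y q.2
    · rcases eq_or_ne (p q) 0 with h0 | h0
      · simp only [f, ← hq, h0, sub_self, zero_mul, le_refl]
      · have ha : pr μ X q.1 ≠ 0 := fun h => h0 (by rw [hq, h, zero_mul])
        have hb : pr μ Y q.2 ≠ 0 := fun h => h0 (by rw [hq, h, mul_zero])
        simp only [f, hq, Real.log_mul ha hb]
        apply le_of_eq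
        ring
    · exact (hpos q hq).le
  by_contra hne
  exact (hpos (x, y) hne).ne'
    ((Finset.sum_eq_zero_iff_of_nonneg hnn).1 hsum (x, y) (Finset.mem_univ _))

lemma support_nonempty (μ : Measure Ω) [IsProbabilityMeasure μ] [Fintype S] [MeasurableSpace S]
    [MeasurableSingletonClass S] {X : Ω → S} (hX : Measurable X) : (support μ X).Nonempty := by
  by_contra hne
  have h0 : ∑ x, pr μ X x ≤ 0 :=
    Finset.sum_nonpos fun x _ => not_lt.1 fun hx => hne ⟨x, hx⟩
  rw [sum_pr_eq_one μ hX] at h0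
  exact absurd h0 (by norm_num)

lemma ncard_support_mul (μ : Measure Ω) [IsProbabilityMeasure μ] [Fintype S] [MeasurableSpace S]
    [MeasurableSingletonClass S] {X : Ω → S} (hX : Measurable X) {c : ℝ}
    (hc : ∀ x ∈ support μ X, pr μ X x = c) : ((support μ X).ncard : ℝ) * c = 1 := by
  classical
  rw [← sum_pr_eq_one μ hX, Set.ncard_eq_toFinset_card', ← nsmul_eq_mul, ← Finset.sum_const,
    Finset.sum_congr rfl fun x hx => (hc x (Set.mem_toFinset.1 hx)).symm]
  refine Finset.sum_subset (Finset.subset_univ _) fun x _ hx => ?_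
  exact le_antisymm (not_lt.1 fun h => hx (Set.mem_toFinset.2 h)) (pr_nonneg μ X x)

/-- Under `TRIPLE`, any jointly possible values have the same point probabilities. -/
lemma TRIPLE.pr_eq_of_pos {U : Type*} (μ : Measure Ω) [IsProbabilityMeasure μ]
    [Fintype S] [Fintype T] [Fintype U]
    [MeasurableSpace S] [MeasurableSingletonClass S]
    [MeasurableSpace T] [MeasurableSingletonClass T]
    [MeasurableSpace U] [MeasurableSingletonClass U]
    {X : Ω → S} {Y : Ω → T} {Z : Ω → U}
    (hX : Measurable X) (hY : Measurable Y) (hZ : Measurable Z)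
    (h : TRIPLE μ X Y Z) {x : S} {y : T} {z : U}
    (hpos : 0 < pr μ (fun ω => (Z ω, (X ω, Y ω))) (z, (x, y))) :
    pr μ X x = pr μ Z z ∧ pr μ Y y = pr μ Z z := by
  obtain ⟨h1, h2, h3, h4, h5, h6⟩ := h
  have e1 : pr μ (fun ω => (X ω, (Y ω, Z ω))) (x, (y, z))
      = pr μ (fun ω => (Z ω, (X ω, Y ω))) (z, (x, y)) := by
    unfold pr
    congr 2
    ext ω
    simp only [Set.mem_preimage, Set.mem_singleton_iff, Prod.mk.injEq]
    tauto
  have e2 : pr μ (fun ω => (Y ω, (X ω, Z ω))) (y, (x, z))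
      = pr μ (fun ω => (Z ω, (X ω, Y ω))) (z, (x, y)) := by
    unfold pr
    congr 2
    ext ω
    simp only [Set.mem_preimage, Set.mem_singleton_iff, Prod.mk.injEq]
    tauto
  have q1 := pr_prodMk_eq_of_condEnt_eq_zero μ hX h1 (e1 ▸ hpos)
  have q2 := pr_prodMk_eq_of_condEnt_eq_zero μ hY h2 (e2 ▸ hpos)
  have q3 := pr_prodMk_eq_of_condEnt_eq_zero μ hZ h3 hpos
  rw [e1, pr_prodMk_eq_mul_of_mi_eq_zero μ hY hZ h6] at q1
  rw [e2, pr_prodMk_eq_mul_of_mi_eq_zero μ hX hZ h5] at q2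
  rw [pr_prodMk_eq_mul_of_mi_eq_zero μ hX hY h4] at q3
  have hx : pr μ X x ≠ 0 := fun h0 => hpos.ne' (by rw [q3, h0, zero_mul])
  have hy : pr μ Y y ≠ 0 := fun h0 => hpos.ne' (by rw [q3, h0, mul_zero])
  refine ⟨mul_left_cancel₀ hy ?_, mul_left_cancel₀ hx ?_⟩
  · rw [← q1, q3, mul_comm]
  · rw [← q2, q3]

end Entropy

/-- if TRIPLE(X,Y,Z) holds then X, Y, Z are uniform over their supports,
the supports have equal cardinality, and all point probabilities on the supports agree. -/
theorem stmt_0 {Ω : Type*} [MeasurableSpace Ω] (μ : Measure Ω) [IsProbabilityMeasure μ]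
    {S T U : Type*} [Fintype S] [Fintype T] [Fintype U]
    [MeasurableSpace S] [MeasurableSingletonClass S]
    [MeasurableSpace T] [MeasurableSingletonClass T]
    [MeasurableSpace U] [MeasurableSingletonClass U]
    (X : Ω → S) (Y : Ω → T) (Z : Ω → U)
    (hX : Measurable X) (hY : Measurable Y) (hZ : Measurable Z)
    (h : TRIPLE μ X Y Z) :
    IsUniform μ X ∧ IsUniform μ Y ∧ IsUniform μ Z ∧
      (support μ X).ncard = (support μ Y).ncard ∧
      (support μ Y).ncard = (support μ Z).ncard ∧
      ∀ x ∈ support μ X, ∀ y ∈ support μ Y, ∀ z ∈ support μ Z,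
        pr μ X x = pr μ Y y ∧ pr μ Y y = pr μ Z z := by
  have hXY : ∀ x ∈ support μ X, ∀ y ∈ support μ Y, pr μ X x = pr μ Y y := by
    intro x hx y hy
    have hxy : 0 < pr μ (fun ω => (X ω, Y ω)) (x, y) := by
      rw [pr_prodMk_eq_mul_of_mi_eq_zero μ hX hY h.2.2.2.1]
      exact mul_pos hx hy
    obtain ⟨z, hz⟩ := exists_pr_prodMk_pos μ hZ hxy
    obtain ⟨hxz, hyz⟩ := h.pr_eq_of_pos μ hX hY hZ hz
    rw [hxz, hyz]
  obtain ⟨x₀, hx₀⟩ := support_nonempty μ hX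
  obtain ⟨y₀, hy₀⟩ := support_nonempty μ hY
  have cY : ∀ y ∈ support μ Y, pr μ Y y = pr μ X x₀ := fun y hy => (hXY x₀ hx₀ y hy).symm
  have cX : ∀ x ∈ support μ X, pr μ X x = pr μ X x₀ := fun x hx =>
    (hXY x hx y₀ hy₀).trans (cY y₀ hy₀)
  have cZ : ∀ z ∈ support μ Z, pr μ Z z = pr μ X x₀ := by
    intro z hz
    obtain ⟨⟨x, y⟩, hxy⟩ := exists_pr_prodMk_pos μ (hX.prodMk hY) hz
    rw [pr_prodMk_swap] at hxy
    have hx : x ∈ support μ X :=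
      hxy.trans_le ((pr_prodMk_le_right μ Z (fun ω => (X ω, Y ω)) z (x, y)).trans
        (pr_prodMk_le_left μ X Y x y))
    rw [← (h.pr_eq_of_pos μ hX hY hZ hxy).1, cX x hx]
  have nX := ncard_support_mul μ hX cX
  have nY := ncard_support_mul μ hY cY
  have nZ := ncard_support_mul μ hZ cZ
  have hc : pr μ X x₀ ≠ 0 := ne_of_gt hx₀
  refine ⟨fun a ha b hb => (cX a ha).trans (cX b hb).symm,
    fun a ha b hb => (cY a ha).trans (cY b hb).symm,
    fun a ha b hb => (cZ a ha).trans (cZ b hb).symm, ?_, ?_, fun x hx y hy z hz =>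
      ⟨hXY x hx y hy, (cY y hy).trans (cZ z hz).symm⟩⟩
  · exact_mod_cast mul_right_cancel₀ hc (nX.trans nY.symm)
  · exact_mod_cast mul_right_cancel₀ hc (nY.trans nZ.symm)

end CIPaper
end

section
/- Assume the SW setup for some k ≥ 1. Then for all subsets S, S̄ ⊆ {1,…,k}: H(F | V_S, V̄_S̄, W) = P(sat(W, S, S̄) = 1), i.e., the conditional entropy of F given the tuples (Vi)_{i∈S}, (V̄i)_{i∈S̄} and W equals the probability that Wi = 1 for all i ∈ S and Wi = 0 for all i ∈ S̄. -/
namespace CIPaper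

open MeasureTheory ProbabilityTheory Real

/-- The conditional entropy of a fair bit `F` given `φ F W`, where `F` is independent of `W` and
`φ F W` determines `W`, is the probability that `φ F W` does not depend on the bit. -/
theorem condEnt_bit_eq {Ω T U : Type*} [MeasurableSpace Ω] (μ : Measure Ω)
    [IsProbabilityMeasure μ] [MeasurableSpace T] [DiscreteMeasurableSpace T] [Fintype U]
    (F : Ω → Fin 2) (W : Ω → T) (hFm : Measurable F) (hWm : Measurable W)
    (hFunif : ∀ x : Fin 2, pr μ F x = 2⁻¹) (hindep : IndepFun F W μ)
    (φ : Fin 2 → T → U) (hφ : ∀ i j w w', φ i w = φ j w' → w = w') :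
    condEnt μ F (fun ω => φ (F ω) (W ω)) =
      (μ {ω | φ 0 (W ω) = φ 1 (W ω)}).toReal := by
  have meas : ∀ s : Set T, MeasurableSet (W ⁻¹' s) := fun s => hWm (MeasurableSet.of_discrete)
  have fiber : ∀ f y, (fun ω => (F ω, φ (F ω) (W ω))) ⁻¹' {(f, y)} =
      F ⁻¹' {f} ∩ W ⁻¹' {w | φ f w = y} := by
    intro f y
    ext ω
    simp only [Set.mem_preimage, Set.mem_singleton_iff, Prod.mk.injEq, Set.mem_inter_iff,
      Set.mem_ofPred_eq]
    exact and_congr_right fun h => by rw [h]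
  have joint : ∀ f y, pr μ (fun ω => (F ω, φ (F ω) (W ω))) (f, y) =
      2⁻¹ * (μ (W ⁻¹' {w | φ f w = y})).toReal := by
    intro f y
    rw [pr, fiber, hindep.measure_inter_preimage_eq_mul _ _ (measurableSet_singleton f)
      MeasurableSet.of_discrete, ENNReal.toReal_mul, ← hFunif f, pr]
  have marginal : ∀ y, pr μ (fun ω => φ (F ω) (W ω)) y =
      ∑ f, pr μ (fun ω => (F ω, φ (F ω) (W ω))) (f, y) := by
    intro y
    have hset : (fun ω => φ (F ω) (W ω)) ⁻¹' {y} =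
        (fun ω => (F ω, φ (F ω) (W ω))) ⁻¹' {(0, y)} ∪
          (fun ω => (F ω, φ (F ω) (W ω))) ⁻¹' {(1, y)} := by
      ext ω
      have := Fin.exists_fin_two.mp ⟨F ω, rfl⟩
      simp only [Set.mem_preimage, Set.mem_singleton_iff, Set.mem_union, Prod.mk.injEq]
      tauto
    have hm : MeasurableSet ((fun ω => (F ω, φ (F ω) (W ω))) ⁻¹' {((1 : Fin 2), y)}) := by
      rw [fiber]
      exact (hFm (measurableSet_singleton 1)).inter (meas _)
    have hd : Disjoint ((fun ω => (F ω, φ (F ω) (W ω))) ⁻¹' {((0 : Fin 2), y)})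
        ((fun ω => (F ω, φ (F ω) (W ω))) ⁻¹' {((1 : Fin 2), y)}) :=
      Disjoint.preimage _ (by simp)
    rw [Fin.sum_univ_two, pr, hset, measure_union hd hm,
      ENNReal.toReal_add (measure_ne_top _ _) (measure_ne_top _ _), pr, pr]
  have term : ∀ y, ∑ f, negMulLog (pr μ (fun ω => (F ω, φ (F ω) (W ω))) (f, y)) -
      negMulLog (pr μ (fun ω => φ (F ω) (W ω)) y) =
      (μ (W ⁻¹' {w | φ 0 w = y ∧ φ 1 w = y})).toReal * Real.log 2 := by
    intro y
    rw [marginal, Fin.sum_univ_two, Fin.sum_univ_two, joint, joint]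
    by_cases h0 : ∃ w, φ 0 w = y
    · by_cases h1 : ∃ w, φ 1 w = y
      · obtain ⟨w, hw⟩ := h0
        obtain ⟨w', hw'⟩ := h1
        obtain rfl := hφ _ _ _ _ (hw.trans hw'.symm)
        have e0 : {v | φ 0 v = y} = {w} := by
          ext v
          exact ⟨fun h => hφ _ _ _ _ (Eq.trans h hw.symm), fun h => by
            rw [Set.mem_singleton_iff.mp h]; exact hw⟩
        have e1 : {v | φ 1 v = y} = {w} := by
          ext v
          exact ⟨fun h => hφ _ _ _ _ (Eq.trans h hw'.symm), fun h => by
            rw [Set.mem_singleton_iff.mp h]; exact hw'⟩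
        rw [Set.ofPred_and, e0, e1, Set.inter_self]
        generalize (μ (W ⁻¹' {w})).toReal = q
        have hq : 2⁻¹ * q + 2⁻¹ * q = q := by ring
        rw [hq, negMulLog_mul]
        simp only [negMulLog, Real.log_inv]
        ring
      · have e1 : {v | φ 1 v = y} = ∅ := by
          ext v; exact ⟨fun h => h1 ⟨v, h⟩, fun h => h.elim⟩
        simp [Set.ofPred_and, e1]
    · have e0 : {v | φ 0 v = y} = ∅ := by
        ext v; exact ⟨fun h => h0 ⟨v, h⟩, fun h => h.elim⟩
      simp [Set.ofPred_and, e0]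
  have total : (μ {ω | φ 0 (W ω) = φ 1 (W ω)}).toReal =
      ∑ y, (μ (W ⁻¹' {w | φ 0 w = y ∧ φ 1 w = y})).toReal := by
    have hset : {ω | φ 0 (W ω) = φ 1 (W ω)} =
        ⋃ y ∈ (Finset.univ : Finset U), W ⁻¹' {w | φ 0 w = y ∧ φ 1 w = y} := by
      ext ω
      simp [eq_comm]
    rw [hset, measure_biUnion_finset _ fun y _ => meas _,
      ENNReal.toReal_sum fun y _ => measure_ne_top _ _]
    intro y _ z _ hyz
    refine Set.disjoint_left.mpr fun ω hy hz => hyz ?_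
    exact hy.1.symm.trans hz.1
  rw [condEnt, ent, ent, ← sub_div, Fintype.sum_prod_type_right, ← Finset.sum_sub_distrib,
    Finset.sum_congr rfl fun y _ => term y, ← Finset.sum_mul, ← total,
    mul_div_cancel_right₀ _ (Real.log_pos one_lt_two).ne']

/-- in the SW setup, for all index sets S, S̄,
H(F | V_S, V̄_S̄, W) = P(Wᵢ = 1 for all i ∈ S and Wᵢ = 0 for all i ∈ S̄). -/
theorem stmt_5 {Ω : Type*} [MeasurableSpace Ω] (μ : Measure Ω) [IsProbabilityMeasure μ]
    (k : ℕ) (hk : 1 ≤ k)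
    (F : Ω → Fin 2) (W : Ω → (Fin k → Fin 2))
    (hFm : Measurable F) (hWm : Measurable W)
    (hFunif : ∀ x : Fin 2, pr μ F x = 2⁻¹)
    (hindep : IndepFun F W μ)
    (V Vb : Fin k → Ω → Fin 2)
    (hV : ∀ i ω, V i ω = (1 - W ω i) * F ω)
    (hVb : ∀ i ω, Vb i ω = W ω i * F ω)
    (S Sb : Finset (Fin k)) :
    condEnt μ F
        (fun ω => ((fun i : S => V i.1 ω), (fun i : Sb => Vb i.1 ω), W ω)) =
      (μ {ω | (∀ i ∈ S, W ω i = 1) ∧ ∀ i ∈ Sb, W ω i = 0}).toReal := by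
  have key := condEnt_bit_eq μ F W hFm hWm hFunif hindep
    (fun f w => ((fun i : S => (1 - w i.1) * f), (fun i : Sb => w i.1 * f), w))
    (fun i j w w' h => (Prod.mk.inj (Prod.mk.inj h).2).2)
  simp only [hV, hVb]
  rw [key]
  congr 2
  ext ω
  have bit : ∀ a : Fin 2, (0 = 1 - a ↔ a = 1) ∧ (0 = a ↔ a = 0) := by decide
  simp only [Set.mem_ofPred_eq, Prod.mk.injEq, funext_iff, mul_zero, mul_one, Subtype.forall,
    and_true, (bit _).1, (bit _).2]

end CIPaper
end

section
/- Assume the SW setup for some k ≥ 1. Then for every fixed bit string w ∈ {0,1}^k: H(F | V_{{i : wi = 1}}, V̄_{{i : wi = 0}}, W) = P(W = w). -/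
namespace CIPaper

open MeasureTheory ProbabilityTheory Real

/-- The entropy sum may be restricted to any set of values that the variable never leaves. -/
lemma sum_negMulLog_pr_eq {Ω S : Type*} [MeasurableSpace Ω] (μ : Measure Ω) [Fintype S]
    (X : Ω → S) (s : Finset S) (hs : ∀ ω, X ω ∈ s) :
    ∑ x, negMulLog (pr μ X x) = ∑ x ∈ s, negMulLog (pr μ X x) := by
  refine (Finset.sum_subset (Finset.subset_univ s) fun x _ hx => ?_).symm
  have : X ⁻¹' {x} = ∅ := by
    ext ω
    simp only [Set.mem_preimage, Set.mem_singleton_iff, Set.mem_empty_iff_false, iff_false]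
    rintro rfl
    exact hx (hs ω)
  simp [pr, this]

/-- Entropy is invariant under a map that is injective on the range of the random variable. -/
lemma ent_comp_of_injOn {Ω S T : Type*} [MeasurableSpace Ω] (μ : Measure Ω)
    [Fintype S] [Fintype T] (X : Ω → S) (φ : S → T) (hφ : Set.InjOn φ (Set.range X)) :
    ent μ (fun ω => φ (X ω)) = ent μ X := by
  classical
  let s : Finset S := Finset.univ.filter (· ∈ Set.range X)
  have hs : ∀ x ∈ s, x ∈ Set.range X := fun x hx => by simpa [s] using hx
  have hX : ∀ ω, X ω ∈ s := fun ω => by simp [s]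
  unfold ent
  rw [sum_negMulLog_pr_eq μ X s hX, sum_negMulLog_pr_eq μ (fun ω => φ (X ω)) (s.image φ)
      fun ω => Finset.mem_image_of_mem φ (hX ω),
    Finset.sum_image fun x hx y hy h => hφ (hs x hx) (hs y hy) h]
  congr 1
  refine Finset.sum_congr rfl fun x hx => ?_
  have : (fun ω => φ (X ω)) ⁻¹' {φ x} = X ⁻¹' {x} := by
    ext ω
    exact ⟨fun h => hφ ⟨ω, rfl⟩ (hs x hx) h, fun h => congrArg φ h⟩
  simp only [pr, this]

/-- Independence from a uniform bit halves the point masses. -/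
lemma pr_prod_uniform_bit {Ω T : Type*} [MeasurableSpace Ω] {μ : Measure Ω}
    [MeasurableSpace T] [MeasurableSingletonClass T] {F : Ω → Fin 2} {W : Ω → T}
    (hF : ∀ x, pr μ F x = 2⁻¹) (hFW : IndepFun F W μ) (f : Fin 2) (w : T) :
    pr μ (fun ω => (F ω, W ω)) (f, w) = pr μ W w / 2 := by
  have h : (fun ω => (F ω, W ω)) ⁻¹' {(f, w)} = F ⁻¹' {f} ∩ W ⁻¹' {w} := by
    ext ω
    simp
  have hf := hF f
  unfold pr at hf ⊢
  rw [h, hFW.measure_inter_preimage_eq_mul _ _ (measurableSet_singleton f)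
    (measurableSet_singleton w), ENNReal.toReal_mul, hf]
  ring

/-- Erasing a uniform bit on the event `W = w` loses `P(W = w)` bits of entropy. -/
lemma ent_sub_ent_erase {Ω T : Type*} [MeasurableSpace Ω] {μ : Measure Ω}
    [Fintype T] [DecidableEq T] [MeasurableSpace T] [MeasurableSingletonClass T]
    {F : Ω → Fin 2} {W : Ω → T}
    (hF : ∀ x, pr μ F x = 2⁻¹) (hFW : IndepFun F W μ) (w : T) :
    ent μ (fun ω => (F ω, W ω)) - ent μ (fun ω => (if W ω = w then 0 else F ω, W ω)) =
      pr μ W w := by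
  have erase_of_ne (f : Fin 2) (v : T) (hv : v ≠ w) :
      pr μ (fun ω => (if W ω = w then 0 else F ω, W ω)) (f, v) =
        pr μ (fun ω => (F ω, W ω)) (f, v) := by
    unfold pr
    congr 2
    ext ω
    by_cases h : W ω = w <;> simp [h, Ne.symm hv]
  have erase_zero : pr μ (fun ω => (if W ω = w then 0 else F ω, W ω)) (0, w) = pr μ W w := by
    unfold pr
    congr 2
    ext ω
    by_cases h : W ω = w <;> simp [h]
  have erase_one : pr μ (fun ω => (if W ω = w then 0 else F ω, W ω)) (1, w) = 0 := by
    have : (fun ω => (if W ω = w then 0 else F ω, W ω)) ⁻¹' {((1 : Fin 2), w)} = ∅ := by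
      ext ω
      by_cases h : W ω = w <;> simp [h]
    simp [pr, this]
  have hlog : log 2 ≠ 0 := (log_pos one_lt_two).ne'
  unfold ent
  rw [← sub_div, div_eq_iff hlog, Fintype.sum_prod_type_right, Fintype.sum_prod_type_right,
    ← Finset.sum_sub_distrib, Finset.sum_eq_single w]
  · simp only [Fin.sum_univ_two, erase_zero, erase_one, pr_prod_uniform_bit hF hFW]
    rcases eq_or_ne (pr μ W w) 0 with h | h
    · simp [h]
    · simp only [negMulLog, log_div h two_ne_zero]
      ring
  · intro v _ hv
    simp [erase_of_ne _ v hv]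
  · simp

/-- in the SW setup, for every fixed bit string w,
H(F | V_{i : wᵢ=1}, V̄_{i : wᵢ=0}, W) = P(W = w). -/
theorem stmt_6 {Ω : Type*} [MeasurableSpace Ω] (μ : Measure Ω) [IsProbabilityMeasure μ]
    (k : ℕ) (hk : 1 ≤ k)
    (F : Ω → Fin 2) (W : Ω → (Fin k → Fin 2))
    (hFm : Measurable F) (hWm : Measurable W)
    (hFunif : ∀ x : Fin 2, pr μ F x = 2⁻¹)
    (hindep : IndepFun F W μ)
    (V Vb : Fin k → Ω → Fin 2)
    (hV : ∀ i ω, V i ω = (1 - W ω i) * F ω)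
    (hVb : ∀ i ω, Vb i ω = W ω i * F ω)
    (w : Fin k → Fin 2) :
    condEnt μ F
        (fun ω => ((fun i : {i : Fin k // w i = 1} => V i.1 ω),
                   (fun i : {i : Fin k // w i = 0} => Vb i.1 ω), W ω)) =
      pr μ W w := by
  let reveal : Fin 2 × (Fin k → Fin 2) →
      ({i : Fin k // w i = 1} → Fin 2) × ({i : Fin k // w i = 0} → Fin 2) × (Fin k → Fin 2) :=
    fun p => (fun i => (1 - p.2 i.1) * p.1, fun i => p.2 i.1 * p.1, p.2)
  have hY : (fun ω => ((fun i : {i : Fin k // w i = 1} => V i.1 ω),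
      (fun i : {i : Fin k // w i = 0} => Vb i.1 ω), W ω)) = fun ω => reveal (F ω, W ω) := by
    funext ω
    simp only [hV, hVb, reveal]
  have hYerase : (fun ω => reveal (F ω, W ω)) =
      fun ω => reveal (if W ω = w then 0 else F ω, W ω) := by
    funext ω
    by_cases h : W ω = w
    · simp only [reveal, h, if_true, Prod.mk.injEq, and_true]
      exact ⟨funext fun i => by simp [i.2], funext fun i => by simp [i.2]⟩
    · simp [h]
  have reveal_injOn : Set.InjOn reveal
      (Set.range fun ω => (if W ω = w then 0 else F ω, W ω)) := by
    rintro _ ⟨ω, rfl⟩ _ ⟨ω', rfl⟩ h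
    simp only [reveal, Prod.mk.injEq] at h
    obtain ⟨h1, h0, hW⟩ := h
    by_cases hw : W ω = w
    · simp [← hW, hw]
    · simp only [← hW, hw, if_false] at h1 h0 ⊢
      obtain ⟨i, hi⟩ := Function.ne_iff.mp hw
      rcases Fin.exists_fin_two.mp ⟨w i, rfl⟩ with hwi | hwi
      · have hWi : W ω i = 1 := by lia
        simpa [hWi] using congrFun h0 ⟨i, hwi⟩
      · have hWi : W ω i = 0 := by lia
        simpa [hWi] using congrFun h1 ⟨i, hwi⟩
  have hpair : ent μ (fun ω => (F ω, reveal (F ω, W ω))) = ent μ (fun ω => (F ω, W ω)) :=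
    ent_comp_of_injOn μ (fun ω => (F ω, W ω)) (fun p => (p.1, reveal p)) fun p _ q _ h => by
      simp only [reveal, Prod.mk.injEq] at h
      exact Prod.ext h.1 h.2.2.2
  rw [hY, condEnt, hpair, hYerase, ent_comp_of_injOn μ _ reveal reveal_injOn,
    ent_sub_ent_erase hFunif hindep]

end CIPaper
end

section
/- Assume the SW setup for some k ≥ 2, and suppose additionally that: H(F | (Vi, Vj), V̄_{{k}}, W) = 0 and H(F | V_{{k}}, (V̄i, V̄j), W) = 0 for all 1 ≤ i < j ≤ k−1; H(F | (V1,…,Vk), W) = 0; and H(F | (V̄1,…,V̄k), W) = 0. Then almost surely W ∈ T_k, where T_k ⊆ {0,1}^k is the set of strings w such that there is exactly one index j ∈ {1,…,k−1} with wj ≠ wk. -/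
namespace CIPaper

open MeasureTheory ProbabilityTheory Real

/-- `negMulLog` is strictly subadditive on positive reals. -/
lemma negMulLog_add_lt {a b : ℝ} (ha : 0 < a) (hb : 0 < b) :
    negMulLog (a + b) < negMulLog a + negMulLog b := by
  have h1 : a * log a < a * log (a + b) :=
    mul_lt_mul_of_pos_left (log_lt_log ha (by linarith)) ha
  have h2 : b * log b < b * log (a + b) :=
    mul_lt_mul_of_pos_left (log_lt_log hb (by linarith)) hb
  simp only [negMulLog]
  linarith

lemma negMulLog_add_le {a b : ℝ} (ha : 0 ≤ a) (hb : 0 ≤ b) :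
    negMulLog (a + b) ≤ negMulLog a + negMulLog b := by
  rcases ha.eq_or_lt with rfl | ha
  · simp
  rcases hb.eq_or_lt with rfl | hb
  · simp
  exact (negMulLog_add_lt ha hb).le

lemma pr_eq_add_of_binary {Ω T : Type*} [MeasurableSpace Ω] (μ : Measure Ω)
    [IsProbabilityMeasure μ] {F : Ω → Fin 2} (hF : Measurable F) (Y : Ω → T) (y : T) :
    pr μ Y y = pr μ (fun ω => (F ω, Y ω)) (0, y) + pr μ (fun ω => (F ω, Y ω)) (1, y) := by
  have h0 : (fun ω => (F ω, Y ω)) ⁻¹' {(0, y)} = Y ⁻¹' {y} ∩ F ⁻¹' {0} := by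
    ext ω; simp [and_comm]
  have h1 : (fun ω => (F ω, Y ω)) ⁻¹' {(1, y)} = Y ⁻¹' {y} \ F ⁻¹' {0} := by
    ext ω
    have : F ω = 1 ↔ ¬ F ω = 0 := by omega
    simp [and_comm, this]
  simp only [pr, h0, h1]
  rw [← ENNReal.toReal_add (measure_ne_top _ _) (measure_ne_top _ _),
    measure_inter_add_sdiff _ (hF (measurableSet_singleton 0))]

/-- If a binary variable is determined by `Y` in the entropic sense, then no value of `Y` is
compatible with both values of the variable. -/
lemma pr_eq_zero_of_condEnt_eq_zero {Ω T : Type*} [MeasurableSpace Ω] (μ : Measure Ω)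
    [IsProbabilityMeasure μ] [Fintype T] {F : Ω → Fin 2} (hF : Measurable F) {Y : Ω → T}
    (h : condEnt μ F Y = 0) (y : T) :
    pr μ (fun ω => (F ω, Y ω)) (0, y) = 0 ∨ pr μ (fun ω => (F ω, Y ω)) (1, y) = 0 := by
  set p : Fin 2 → T → ℝ := fun x y => pr μ (fun ω => (F ω, Y ω)) (x, y)
  have hp (x y) : 0 ≤ p x y := ENNReal.toReal_nonneg
  have hle (y : T) : negMulLog (pr μ Y y) ≤ negMulLog (p 0 y) + negMulLog (p 1 y) := by
    rw [pr_eq_add_of_binary μ hF]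
    exact negMulLog_add_le (hp 0 y) (hp 1 y)
  have hsum : ∑ y, negMulLog (pr μ Y y) = ∑ y, (negMulLog (p 0 y) + negMulLog (p 1 y)) := by
    have hlog : log 2 ≠ 0 := (log_pos one_lt_two).ne'
    rw [condEnt, ent, ent, ← sub_div, div_eq_zero_iff, or_iff_left hlog, Fintype.sum_prod_type,
      Fin.sum_univ_two, ← Finset.sum_add_distrib] at h
    exact (sub_eq_zero.1 h).symm
  have heq := (Finset.sum_eq_sum_iff_of_le fun y _ => hle y).1 hsum y (Finset.mem_univ y)
  by_contra! hne
  refine heq.not_lt ?_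
  rw [pr_eq_add_of_binary μ hF]
  exact negMulLog_add_lt ((hp 0 y).lt_of_ne' hne.1) ((hp 1 y).lt_of_ne' hne.2)

/-- If `F` is an unbiased bit independent of `W` and is determined by `g F W`, then `g · w`
separates the two values of the bit for every `w` of positive probability. -/
lemma ne_of_condEnt_eq_zero {Ω S T : Type*} [MeasurableSpace Ω] (μ : Measure Ω)
    [IsProbabilityMeasure μ] [MeasurableSpace S] [MeasurableSingletonClass S] [Fintype T]
    {F : Ω → Fin 2} {W : Ω → S} (hF : Measurable F)
    (hunif : ∀ x, pr μ F x = 2⁻¹) (hindep : IndepFun F W μ) (g : Fin 2 → S → T)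
    (h : condEnt μ F (fun ω => g (F ω) (W ω)) = 0) {w : S} (hw : μ (W ⁻¹' {w}) ≠ 0) :
    g 0 w ≠ g 1 w := by
  intro hg
  have key (x : Fin 2) : pr μ (fun ω => (F ω, g (F ω) (W ω))) (x, g x w) ≠ 0 := by
    have hx : μ (F ⁻¹' {x}) ≠ 0 := by
      intro h0
      have := hunif x
      simp [pr, h0] at this
    have hpos : μ (F ⁻¹' {x} ∩ W ⁻¹' {w}) ≠ 0 := by
      rw [hindep.measure_inter_preimage_eq_mul _ _ (measurableSet_singleton x)
        (measurableSet_singleton w)]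
      exact mul_ne_zero hx hw
    refine ENNReal.toReal_ne_zero.2 ⟨fun h0 => hpos (measure_mono_null ?_ h0), measure_ne_top _ _⟩
    rintro ω ⟨rfl, rfl⟩
    rfl
  rcases pr_eq_zero_of_condEnt_eq_zero μ hF h (g 0 w) with h0 | h1
  · exact key 0 h0
  · exact key 1 (hg ▸ h1)

lemma card_filter_eq_one_of_exists_of_lt {n : ℕ} {P : Fin n → Prop} [DecidablePred P]
    (hex : ∃ j, P j) (hlt : ∀ i j, i < j → P j → ¬ P i) :
    (Finset.univ.filter P).card = 1 := by
  obtain ⟨j, hj⟩ := hex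
  refine Finset.card_eq_one.2 ⟨j, ?_⟩
  ext i
  simp only [Finset.mem_filter, Finset.mem_univ, true_and, Finset.mem_singleton]
  refine ⟨fun hi => ?_, fun hi => hi ▸ hj⟩
  rcases lt_trichotomy i j with h | h | h
  · exact absurd hi (hlt i j h hj)
  · exact h
  · exact absurd hj (hlt j i h hi)

/-- in the SW setup with k = m + 2 ≥ 2, the COL' constraints force W to lie,
almost surely, in the set T_k of strings with exactly one index j among the first k−1
coordinates such that w j ≠ w (last coordinate). -/
theorem stmt_7 {Ω : Type*} [MeasurableSpace Ω] (μ : Measure Ω) [IsProbabilityMeasure μ]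
    (m : ℕ)
    (F : Ω → Fin 2) (W : Ω → (Fin (m + 2) → Fin 2))
    (hFm : Measurable F) (hWm : Measurable W)
    (hFunif : ∀ x : Fin 2, pr μ F x = 2⁻¹)
    (hindep : IndepFun F W μ)
    (V Vb : Fin (m + 2) → Ω → Fin 2)
    (hV : ∀ i ω, V i ω = (1 - W ω i) * F ω)
    (hVb : ∀ i ω, Vb i ω = W ω i * F ω)
    (h1 : ∀ i j : Fin (m + 2), i < j → (j : ℕ) < m + 1 →
      condEnt μ F (fun ω => (V i ω, V j ω, Vb (Fin.last (m + 1)) ω, W ω)) = 0)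
    (h2 : ∀ i j : Fin (m + 2), i < j → (j : ℕ) < m + 1 →
      condEnt μ F (fun ω => (V (Fin.last (m + 1)) ω, Vb i ω, Vb j ω, W ω)) = 0)
    (h3 : condEnt μ F (fun ω => ((fun i => V i ω), W ω)) = 0)
    (h4 : condEnt μ F (fun ω => ((fun i => Vb i ω), W ω)) = 0) :
    μ {ω | (Finset.univ.filter fun j : Fin (m + 2) =>
        j ≠ Fin.last (m + 1) ∧ W ω j ≠ W ω (Fin.last (m + 1))).card = 1} = 1 := by
  obtain rfl : V = fun i ω => (1 - W ω i) * F ω := by ext1 i; ext1 ω; exact hV i ω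
  obtain rfl : Vb = fun i ω => W ω i * F ω := by ext1 i; ext1 ω; exact hVb i ω
  have bit (a : Fin 2) : a = 0 ∨ a = 1 := by omega
  suffices hae : ∀ᵐ ω ∂μ, (Finset.univ.filter fun j : Fin (m + 2) =>
      j ≠ Fin.last (m + 1) ∧ W ω j ≠ W ω (Fin.last (m + 1))).card = 1 by
    rw [measure_congr (Filter.eventuallyEq_univ.2 hae), measure_univ]
  have hnull : ∀ᵐ ω ∂μ, ∀ w, μ (W ⁻¹' {w}) = 0 → W ω ≠ w := by
    refine ae_all_iff.2 fun w => ?_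
    by_cases hw : μ (W ⁻¹' {w}) = 0
    · filter_upwards [measure_eq_zero_iff_ae_notMem.1 hw] with ω hω _ using hω
    · exact Filter.Eventually.of_forall fun ω h => absurd h hw
  filter_upwards [hnull] with ω hω
  have hw : μ (W ⁻¹' {W ω}) ≠ 0 := fun h => hω _ h rfl
  generalize W ω = w at hw
  have e3 : ∃ i, w i = 0 := by
    by_contra! hne
    refine ne_of_condEnt_eq_zero μ hFm hFunif hindep
      (fun f w => ((fun i => (1 - w i) * f), w)) h3 hw ?_
    simp [fun i => (bit (w i)).resolve_left (hne i)]
  have e4 : ∃ i, w i = 1 := by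
    by_contra! hne
    refine ne_of_condEnt_eq_zero μ hFm hFunif hindep
      (fun f w => ((fun i => w i * f), w)) h4 hw ?_
    simp [fun i => (bit (w i)).resolve_right (hne i)]
  apply card_filter_eq_one_of_exists_of_lt
  · rcases bit (w (Fin.last (m + 1))) with hl | hl
    · obtain ⟨i, hi⟩ := e4
      have hne : w i ≠ w (Fin.last (m + 1)) := by simp [hi, hl]
      exact ⟨i, fun h => hne (h ▸ rfl), hne⟩
    · obtain ⟨i, hi⟩ := e3
      have hne : w i ≠ w (Fin.last (m + 1)) := by simp [hi, hl]
      exact ⟨i, fun h => hne (h ▸ rfl), hne⟩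
  · rintro i j hij ⟨hj, hwj⟩ ⟨-, hwi⟩
    have hjm : (j : ℕ) < m + 1 := Fin.val_lt_last hj
    rcases bit (w (Fin.last (m + 1))) with hl | hl
    · refine ne_of_condEnt_eq_zero μ hFm hFunif hindep
        (fun f w => ((1 - w i) * f, (1 - w j) * f, w (Fin.last (m + 1)) * f, w))
        (h1 i j hij hjm) hw ?_
      rw [hl] at hwi hwj
      simp [hl, (bit _).resolve_left hwi, (bit _).resolve_left hwj]
    · refine ne_of_condEnt_eq_zero μ hFm hFunif hindep
        (fun f w => ((1 - w (Fin.last (m + 1))) * f, w i * f, w j * f, w))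
        (h2 i j hij hjm) hw ?_
      rw [hl] at hwi hwj
      simp [hl, (bit _).resolve_right hwi, (bit _).resolve_right hwj]

end CIPaper
end
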